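/- Let N ≥ 1. For every x0 ∈ ℙ_N, the extended optimal trajectory satisfies x*(k) ∈ ℙ_N for every k ≥ 0; in particular ℙ_N is positive invariant under the open-loop optimally controlled system x(k+1) = A x(k) + B u*(k). -/

import Mathlib

open Matrix Set

noncomputable section

/-- State trajectory generated by dynamics `x(k+1) = A x(k) + B u(k)` from `x0`. -/
def traj {n m : ℕ} (A : Matrix (Fin n) (Fin n) ℝ) (B : Matrix (Fin n) (Fin m) ℝ)
    (x0 : Fin n → ℝ) (u : ℕ → Fin m → ℝ) : ℕ → Fin n → ℝ
  | 0 => x0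
  | k + 1 => A *ᵥ traj A B x0 u k + B *ᵥ u k

/-- Feasibility of a control sequence for horizon `N` and initial state `x0`. -/
def Feasible {n m qX qU qT : ℕ} (A : Matrix (Fin n) (Fin n) ℝ) (B : Matrix (Fin n) (Fin m) ℝ)
    (Cx : Matrix (Fin qX) (Fin n) ℝ) (cx : Fin qX → ℝ)
    (Cu : Matrix (Fin qU) (Fin m) ℝ) (cu : Fin qU → ℝ)
    (Ct : Matrix (Fin qT) (Fin n) ℝ) (ct : Fin qT → ℝ)
    (N : ℕ) (x0 : Fin n → ℝ) (u : ℕ → Fin m → ℝ) : Prop :=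
  (∀ k < N, Cx *ᵥ traj A B x0 u k ≤ cx ∧ Cu *ᵥ u k ≤ cu) ∧
    Ct *ᵥ traj A B x0 u N ≤ ct

/-- The quadratic cost `J_N(x0, u)`. -/
def cost {n m : ℕ} (A : Matrix (Fin n) (Fin n) ℝ) (B : Matrix (Fin n) (Fin m) ℝ)
    (Q : Matrix (Fin n) (Fin n) ℝ) (R : Matrix (Fin m) (Fin m) ℝ)
    (P : Matrix (Fin n) (Fin n) ℝ)
    (N : ℕ) (x0 : Fin n → ℝ) (u : ℕ → Fin m → ℝ) : ℝ :=
  (1 / 2) * (traj A B x0 u N ⬝ᵥ (P *ᵥ traj A B x0 u N)) +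
    (1 / 2) * ∑ k ∈ Finset.range N,
      (traj A B x0 u k ⬝ᵥ (Q *ᵥ traj A B x0 u k) + u k ⬝ᵥ (R *ᵥ u k))

/-- `u` is an optimal (feasible, cost-minimizing) sequence for horizon `N` at `x0`. -/
def IsOptimal {n m qX qU qT : ℕ} (A : Matrix (Fin n) (Fin n) ℝ) (B : Matrix (Fin n) (Fin m) ℝ)
    (Q : Matrix (Fin n) (Fin n) ℝ) (R : Matrix (Fin m) (Fin m) ℝ)
    (P : Matrix (Fin n) (Fin n) ℝ)
    (Cx : Matrix (Fin qX) (Fin n) ℝ) (cx : Fin qX → ℝ)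
    (Cu : Matrix (Fin qU) (Fin m) ℝ) (cu : Fin qU → ℝ)
    (Ct : Matrix (Fin qT) (Fin n) ℝ) (ct : Fin qT → ℝ)
    (N : ℕ) (x0 : Fin n → ℝ) (u : ℕ → Fin m → ℝ) : Prop :=
  Feasible A B Cx cx Cu cu Ct ct N x0 u ∧
    ∀ v, Feasible A B Cx cx Cu cu Ct ct N x0 v →
      cost A B Q R P N x0 u ≤ cost A B Q R P N x0 v

/-- The feasible set `F_N` of initial states. -/
def FeasSet {n m qX qU qT : ℕ} (A : Matrix (Fin n) (Fin n) ℝ) (B : Matrix (Fin n) (Fin m) ℝ)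
    (Cx : Matrix (Fin qX) (Fin n) ℝ) (cx : Fin qX → ℝ)
    (Cu : Matrix (Fin qU) (Fin m) ℝ) (cu : Fin qU → ℝ)
    (Ct : Matrix (Fin qT) (Fin n) ℝ) (ct : Fin qT → ℝ)
    (N : ℕ) : Set (Fin n → ℝ) :=
  {x0 | ∃ u, Feasible A B Cx cx Cu cu Ct ct N x0 u}

section Trajectories

variable {n m : ℕ} (A : Matrix (Fin n) (Fin n) ℝ) (B : Matrix (Fin n) (Fin m) ℝ)

theorem traj_congr (x0 : Fin n → ℝ) {u v : ℕ → Fin m → ℝ} :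
    ∀ {N : ℕ}, (∀ k < N, u k = v k) → traj A B x0 u N = traj A B x0 v N
  | 0, _ => rfl
  | N + 1, h => by
    simp only [traj]
    rw [traj_congr x0 (N := N) fun k hk => h k (by omega), h N (by omega)]

theorem traj_add (x0 : Fin n → ℝ) (u : ℕ → Fin m → ℝ) (k : ℕ) :
    ∀ j, traj A B (traj A B x0 u k) (fun i => u (k + i)) j = traj A B x0 u (k + j)
  | 0 => rfl
  | j + 1 => by
    rw [← Nat.add_assoc]
    simp only [traj]
    rw [traj_add x0 u k j]

theorem traj_succ' (x0 : Fin n → ℝ) (u : ℕ → Fin m → ℝ) (j : ℕ) :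
    traj A B x0 u (j + 1) = traj A B (A *ᵥ x0 + B *ᵥ u 0) (fun i => u (i + 1)) j := by
  have h := traj_add A B x0 u 1 j
  simp only [Nat.add_comm 1] at h
  exact h.symm

theorem traj_zero_sub (x0 : Fin n → ℝ) (u v : ℕ → Fin m → ℝ) :
    ∀ k, traj A B 0 (v - u) k = traj A B x0 v k - traj A B x0 u k
  | 0 => by simp [traj]
  | k + 1 => by
    simp only [traj, traj_zero_sub x0 u v k, Pi.sub_apply, mulVec_sub]
    abel

theorem traj_segment (x0 : Fin n → ℝ) (u v : ℕ → Fin m → ℝ) (t : ℝ) :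
    ∀ k, traj A B x0 (u + t • (v - u)) k =
      traj A B x0 u k + t • (traj A B x0 v k - traj A B x0 u k)
  | 0 => by simp [traj]
  | k + 1 => by
    rw [traj, traj_segment x0 u v t k]
    simp only [traj, Pi.add_apply, Pi.smul_apply, Pi.sub_apply,
      mulVec_add, mulVec_smul, mulVec_sub, smul_add, smul_sub]
    abel

end Trajectories

theorem dotProduct_mulVec_segment {ι : Type*} [Fintype ι] (M : Matrix ι ι ℝ) (a b : ι → ℝ)
    (t : ℝ) :
    (a + t • (b - a)) ⬝ᵥ (M *ᵥ (a + t • (b - a))) =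
      (1 - t) * (a ⬝ᵥ (M *ᵥ a)) + t * (b ⬝ᵥ (M *ᵥ b))
        - t * (1 - t) * ((b - a) ⬝ᵥ (M *ᵥ (b - a))) := by
  simp only [mulVec_add, mulVec_smul, mulVec_sub, add_dotProduct, dotProduct_add,
    smul_dotProduct, dotProduct_smul, sub_dotProduct, dotProduct_sub, smul_eq_mul]
  ring

theorem mulVec_le_segment {ι κ : Type*} [Fintype κ] (C : Matrix ι κ ℝ) (c : ι → ℝ)
    {a b : κ → ℝ} {t : ℝ} (h0 : 0 ≤ t) (h1 : t ≤ 1) (ha : C *ᵥ a ≤ c) (hb : C *ᵥ b ≤ c) :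
    C *ᵥ (a + t • (b - a)) ≤ c := by
  intro i
  have hai := ha i
  have hbi := hb i
  simp only [mulVec_add, mulVec_smul, mulVec_sub, Pi.add_apply, Pi.smul_apply, Pi.sub_apply,
    smul_eq_mul]
  nlinarith [mul_nonneg h0 (sub_nonneg.2 hbi), mul_nonneg (sub_nonneg.2 h1) (sub_nonneg.2 hai)]

/-- A point satisfying finitely many strict linear inequalities can be moved a little way in any
direction. -/
theorem exists_pos_forall_mulVec_add_smul_lt {ι κ : Type*} [Finite ι] [Fintype κ]
    (C : Matrix ι κ ℝ) (c : ι → ℝ) (a d : κ → ℝ) (h : ∀ i, (C *ᵥ a) i < c i) :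
    ∃ t : ℝ, 0 < t ∧ t < 1 ∧ ∀ i, (C *ᵥ (a + t • d)) i < c i := by
  have hev : ∀ᶠ t : ℝ in nhdsWithin 0 (Ioi 0), ∀ i, (C *ᵥ (a + t • d)) i < c i := by
    rw [Filter.eventually_all]
    intro i
    have hc : Continuous fun t : ℝ => (C *ᵥ (a + t • d)) i := by
      simp only [mulVec_add, mulVec_smul, Pi.add_apply, Pi.smul_apply, smul_eq_mul]
      fun_prop
    exact nhdsWithin_le_nhds
      (hc.continuousAt.eventually_lt continuousAt_const (by simpa using h i))
  obtain ⟨t, ht, ht0, ht1⟩ := (hev.and (Ioo_mem_nhdsGT one_pos)).exists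
  exact ⟨t, ht0, ht1, ht⟩

section Cost

variable {n m : ℕ} (A : Matrix (Fin n) (Fin n) ℝ) (B : Matrix (Fin n) (Fin m) ℝ)
  (Q : Matrix (Fin n) (Fin n) ℝ) (R : Matrix (Fin m) (Fin m) ℝ) (P : Matrix (Fin n) (Fin n) ℝ)

theorem cost_segment (N : ℕ) (x0 : Fin n → ℝ) (u v : ℕ → Fin m → ℝ) (t : ℝ) :
    cost A B Q R P N x0 (u + t • (v - u)) =
      (1 - t) * cost A B Q R P N x0 u + t * cost A B Q R P N x0 v
        - t * (1 - t) * cost A B Q R P N 0 (v - u) := by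
  have hsum : ∑ k ∈ Finset.range N, (traj A B x0 (u + t • (v - u)) k ⬝ᵥ
        (Q *ᵥ traj A B x0 (u + t • (v - u)) k) +
        (u + t • (v - u)) k ⬝ᵥ (R *ᵥ (u + t • (v - u)) k)) =
      (1 - t) * ∑ k ∈ Finset.range N,
        (traj A B x0 u k ⬝ᵥ (Q *ᵥ traj A B x0 u k) + u k ⬝ᵥ (R *ᵥ u k)) +
      t * ∑ k ∈ Finset.range N,
        (traj A B x0 v k ⬝ᵥ (Q *ᵥ traj A B x0 v k) + v k ⬝ᵥ (R *ᵥ v k)) -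
      t * (1 - t) * ∑ k ∈ Finset.range N, (traj A B 0 (v - u) k ⬝ᵥ (Q *ᵥ traj A B 0 (v - u) k) +
        (v - u) k ⬝ᵥ (R *ᵥ (v - u) k)) := by
    rw [Finset.mul_sum, Finset.mul_sum, Finset.mul_sum, ← Finset.sum_add_distrib,
      ← Finset.sum_sub_distrib]
    refine Finset.sum_congr rfl fun k _ => ?_
    rw [traj_segment, traj_zero_sub A B x0, dotProduct_mulVec_segment]
    have hu := dotProduct_mulVec_segment R (u k) (v k) t
    simp only [Pi.add_apply, Pi.smul_apply, Pi.sub_apply]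
    rw [hu]
    ring
  simp only [cost]
  rw [hsum, traj_segment, traj_zero_sub A B x0, dotProduct_mulVec_segment]
  ring

variable {Q R P}

theorem Matrix.PosSemidef.dotProduct_mulVec_self_nonneg {ι : Type*} [Fintype ι]
    {M : Matrix ι ι ℝ} (hM : M.PosSemidef) (x : ι → ℝ) : 0 ≤ x ⬝ᵥ (M *ᵥ x) := by
  simpa using hM.dotProduct_mulVec_nonneg x

theorem stage_cost_nonneg (hQ : Q.PosSemidef) (hR : R.PosDef) (x : Fin n → ℝ) (u : Fin m → ℝ) :
    0 ≤ x ⬝ᵥ (Q *ᵥ x) + u ⬝ᵥ (R *ᵥ u) :=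
  add_nonneg (hQ.dotProduct_mulVec_self_nonneg x)
    (hR.posSemidef.dotProduct_mulVec_self_nonneg u)

theorem cost_nonneg (hQ : Q.PosSemidef) (hR : R.PosDef) (hP : P.PosSemidef) (N : ℕ)
    (x0 : Fin n → ℝ) (u : ℕ → Fin m → ℝ) : 0 ≤ cost A B Q R P N x0 u := by
  have hs := Finset.sum_nonneg fun k (_ : k ∈ Finset.range N) =>
    stage_cost_nonneg hQ hR (traj A B x0 u k) (u k)
  have ht := hP.dotProduct_mulVec_self_nonneg (traj A B x0 u N)
  simp only [cost]
  linarith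

theorem eq_zero_of_cost_nonpos (hQ : Q.PosSemidef) (hR : R.PosDef) (hP : P.PosSemidef) {N : ℕ}
    {x0 : Fin n → ℝ} {u : ℕ → Fin m → ℝ} (h : cost A B Q R P N x0 u ≤ 0) {k : ℕ} (hk : k < N) :
    u k = 0 := by
  have hs := Finset.single_le_sum (fun k (_ : k ∈ Finset.range N) =>
    stage_cost_nonneg hQ hR (traj A B x0 u k) (u k)) (Finset.mem_range.2 hk)
  have ht := hP.dotProduct_mulVec_self_nonneg (traj A B x0 u N)
  have hq := hQ.dotProduct_mulVec_self_nonneg (traj A B x0 u k)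
  simp only [cost] at h
  by_contra hne
  have hr : 0 < u k ⬝ᵥ (R *ᵥ u k) := by simpa using hR.dotProduct_mulVec_pos hne
  linarith

theorem cost_succ' (N : ℕ) (x0 : Fin n → ℝ) (u : ℕ → Fin m → ℝ) :
    cost A B Q R P (N + 1) x0 u = (1 / 2) * (x0 ⬝ᵥ (Q *ᵥ x0) + u 0 ⬝ᵥ (R *ᵥ u 0)) +
      cost A B Q R P N (A *ᵥ x0 + B *ᵥ u 0) (fun i => u (i + 1)) := by
  simp only [cost, Finset.sum_range_succ', traj_succ' A B x0 u]
  simp only [traj]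
  ring

theorem cost_succ (N : ℕ) (x0 : Fin n → ℝ) (u : ℕ → Fin m → ℝ) :
    cost A B Q R P (N + 1) x0 u = cost A B Q R P N x0 u + (1 / 2) *
      ((A *ᵥ traj A B x0 u N + B *ᵥ u N) ⬝ᵥ (P *ᵥ (A *ᵥ traj A B x0 u N + B *ᵥ u N)) +
        traj A B x0 u N ⬝ᵥ (Q *ᵥ traj A B x0 u N) + u N ⬝ᵥ (R *ᵥ u N) -
        traj A B x0 u N ⬝ᵥ (P *ᵥ traj A B x0 u N)) := by
  simp only [cost, Finset.sum_range_succ, traj]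
  ring

/-- Completion of squares for the discrete-time algebraic Riccati equation. -/
theorem riccati_completion_of_squares {Kinf : Matrix (Fin m) (Fin n) ℝ} (hP : P.IsHermitian)
    (hR : R.IsHermitian) (hdet : IsUnit (R + Bᵀ * P * B).det)
    (hRic : P = Aᵀ * (P - P * B * (R + Bᵀ * P * B)⁻¹ * (Bᵀ * P)) * A + Q)
    (hK : Kinf = -((Bᵀ * P * B + R)⁻¹ * (Bᵀ * P * A))) (x : Fin n → ℝ) (u : Fin m → ℝ) :
    (A *ᵥ x + B *ᵥ u) ⬝ᵥ (P *ᵥ (A *ᵥ x + B *ᵥ u)) + x ⬝ᵥ (Q *ᵥ x) + u ⬝ᵥ (R *ᵥ u) =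
      x ⬝ᵥ (P *ᵥ x) +
        (u - Kinf *ᵥ x) ⬝ᵥ ((R + Bᵀ * P * B) *ᵥ (u - Kinf *ᵥ x)) := by
  have hSK : (R + Bᵀ * P * B) * Kinf = -(Bᵀ * P * A) := by
    rw [hK, add_comm (Bᵀ * P * B) R, Matrix.mul_neg, Matrix.mul_nonsing_inv_cancel_left _ _ hdet]
  have hPK : P = Aᵀ * P * A + Aᵀ * P * B * Kinf + Q := by
    conv_lhs => rw [hRic]
    rw [hK, add_comm (Bᵀ * P * B) R]
    generalize (R + Bᵀ * P * B)⁻¹ = S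
    simp only [Matrix.mul_add, Matrix.add_mul, Matrix.mul_neg, Matrix.neg_mul, Matrix.mul_assoc,
      sub_eq_add_neg]
  have hform (v : Fin m → ℝ) : v ⬝ᵥ (R *ᵥ (Kinf *ᵥ x)) +
      (B *ᵥ v) ⬝ᵥ (P *ᵥ (B *ᵥ (Kinf *ᵥ x))) = -((B *ᵥ v) ⬝ᵥ (P *ᵥ (A *ᵥ x))) := by
    have h := congrArg (fun M => v ⬝ᵥ (M *ᵥ x)) hSK
    simp only [Matrix.add_mul, add_mulVec, ← mulVec_mulVec, neg_mulVec, dotProduct_add,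
      dotProduct_neg] at h
    simpa only [dotProduct_mulVec, vecMul_transpose] using h
  have hPx : x ⬝ᵥ (P *ᵥ x) = (A *ᵥ x) ⬝ᵥ (P *ᵥ (A *ᵥ x)) +
      (A *ᵥ x) ⬝ᵥ (P *ᵥ (B *ᵥ (Kinf *ᵥ x))) + x ⬝ᵥ (Q *ᵥ x) := by
    have h := congrArg (fun M => x ⬝ᵥ (M *ᵥ x)) hPK
    simp only [add_mulVec, ← mulVec_mulVec, dotProduct_add] at h
    simpa only [dotProduct_mulVec, vecMul_transpose] using h
  have hsymm {k : ℕ} {M : Matrix (Fin k) (Fin k) ℝ} (hM : M.IsHermitian) (a b : Fin k → ℝ) :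
      a ⬝ᵥ (M *ᵥ b) = b ⬝ᵥ (M *ᵥ a) := by
    have hMt : Mᵀ = M := by simpa [Matrix.IsHermitian, conjTranspose_eq_transpose_of_trivial] using hM
    rw [dotProduct_mulVec, ← mulVec_transpose, hMt, dotProduct_comm]
  have hS (a b : Fin m → ℝ) : a ⬝ᵥ ((R + Bᵀ * P * B) *ᵥ b) =
      a ⬝ᵥ (R *ᵥ b) + (B *ᵥ a) ⬝ᵥ (P *ᵥ (B *ᵥ b)) := by
    simp only [add_mulVec, ← mulVec_mulVec, dotProduct_add]
    simp only [dotProduct_mulVec, vecMul_transpose]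
  have h1 := hform u
  have h2 := hform (Kinf *ᵥ x)
  have h3 := hsymm hR u (Kinf *ᵥ x)
  have h4 := hsymm hP (B *ᵥ u) (B *ᵥ (Kinf *ᵥ x))
  have h5 := hsymm hP (B *ᵥ u) (A *ᵥ x)
  have h6 := hsymm hP (B *ᵥ (Kinf *ᵥ x)) (A *ᵥ x)
  rw [hS]
  simp only [mulVec_sub, mulVec_add, add_dotProduct, dotProduct_add, sub_dotProduct,
    dotProduct_sub]
  linarith

end Cost

section Optimality

variable {n m qX qU qT : ℕ} {A : Matrix (Fin n) (Fin n) ℝ} {B : Matrix (Fin n) (Fin m) ℝ}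
  {Q : Matrix (Fin n) (Fin n) ℝ} {R : Matrix (Fin m) (Fin m) ℝ} {P : Matrix (Fin n) (Fin n) ℝ}
  {Cx : Matrix (Fin qX) (Fin n) ℝ} {cx : Fin qX → ℝ}
  {Cu : Matrix (Fin qU) (Fin m) ℝ} {cu : Fin qU → ℝ}
  {Ct : Matrix (Fin qT) (Fin n) ℝ} {ct : Fin qT → ℝ}
  {N : ℕ} {x0 : Fin n → ℝ} {u v : ℕ → Fin m → ℝ}

theorem Feasible.congr (hu : Feasible A B Cx cx Cu cu Ct ct N x0 u) (h : ∀ k < N, u k = v k) :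
    Feasible A B Cx cx Cu cu Ct ct N x0 v := by
  refine ⟨fun k hk => ?_, ?_⟩
  · rw [← traj_congr A B x0 fun j (hj : j < k) => h j (hj.trans hk), ← h k hk]
    exact hu.1 k hk
  · rw [← traj_congr A B x0 h]
    exact hu.2

theorem cost_congr (h : ∀ k < N, u k = v k) :
    cost A B Q R P N x0 u = cost A B Q R P N x0 v := by
  simp only [cost, traj_congr A B x0 h]
  congr 2
  refine Finset.sum_congr rfl fun k hk => ?_
  have hk := Finset.mem_range.1 hk
  rw [← traj_congr A B x0 fun j (hj : j < k) => h j (hj.trans hk), ← h k hk]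

theorem IsOptimal.congr (hu : IsOptimal A B Q R P Cx cx Cu cu Ct ct N x0 u)
    (h : ∀ k < N, u k = v k) : IsOptimal A B Q R P Cx cx Cu cu Ct ct N x0 v :=
  ⟨hu.1.congr h, fun w hw => cost_congr (Q := Q) (R := R) (P := P) h ▸ hu.2 w hw⟩

theorem Feasible.segment (hu : Feasible A B Cx cx Cu cu Ct ct N x0 u)
    (hv : ∀ k < N, Cx *ᵥ traj A B x0 v k ≤ cx ∧ Cu *ᵥ v k ≤ cu) {t : ℝ} (h0 : 0 ≤ t) (h1 : t ≤ 1)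
    (hT : Ct *ᵥ (traj A B x0 u N + t • (traj A B x0 v N - traj A B x0 u N)) ≤ ct) :
    Feasible A B Cx cx Cu cu Ct ct N x0 (u + t • (v - u)) := by
  refine ⟨fun k hk => ⟨?_, ?_⟩, ?_⟩
  · rw [traj_segment]
    exact mulVec_le_segment Cx cx h0 h1 (hu.1 k hk).1 (hv k hk).1
  · exact mulVec_le_segment Cu cu h0 h1 (hu.1 k hk).2 (hv k hk).2
  · rw [traj_segment]
    exact hT

/-- The optimal control sequence is unique on the horizon. -/
theorem IsOptimal.eq_of_lt (hQ : Q.PosSemidef) (hR : R.PosDef) (hP : P.PosSemidef)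
    (hu : IsOptimal A B Q R P Cx cx Cu cu Ct ct N x0 u)
    (hv : IsOptimal A B Q R P Cx cx Cu cu Ct ct N x0 v) {k : ℕ} (hk : k < N) : v k = u k := by
  have hf := hu.2 _ (hu.1.segment hv.1.1 (t := 1 / 2) (by norm_num) (by norm_num)
    (mulVec_le_segment Ct ct (by norm_num) (by norm_num) hu.1.2 hv.1.2))
  have hvu := hv.2 u hu.1
  rw [cost_segment] at hf
  have hd : cost A B Q R P N 0 (v - u) ≤ 0 := by linarith
  exact sub_eq_zero.1 (eq_zero_of_cost_nonpos A B hQ hR hP hd hk)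

/-- If no terminal constraint is active at the optimum, then dropping the terminal constraints does
not lower the optimal cost. -/
theorem IsOptimal.cost_le_of_terminal_inactive (hQ : Q.PosSemidef) (hR : R.PosDef)
    (hP : P.PosSemidef) (hu : IsOptimal A B Q R P Cx cx Cu cu Ct ct N x0 u)
    (hT : ∀ r, (Ct *ᵥ traj A B x0 u N) r < ct r)
    (hv : ∀ k < N, Cx *ᵥ traj A B x0 v k ≤ cx ∧ Cu *ᵥ v k ≤ cu) :
    cost A B Q R P N x0 u ≤ cost A B Q R P N x0 v := by
  obtain ⟨t, h0, h1, ht⟩ := exists_pos_forall_mulVec_add_smul_lt Ct ct _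
    (traj A B x0 v N - traj A B x0 u N) hT
  have hf := hu.2 _ (hu.1.segment hv h0.le h1.le fun r => (ht r).le)
  rw [cost_segment] at hf
  have hd := mul_nonneg (mul_nonneg h0.le (sub_nonneg.2 h1.le))
    (cost_nonneg A B hQ hR hP N 0 (v - u))
  exact le_of_mul_le_mul_left (by linarith) h0

/-- A linear map preserving a polyhedron with the origin in its interior preserves its interior. -/
theorem mulVec_lt_of_invariant (M : Matrix (Fin n) (Fin n) ℝ) (h0 : ∀ r, 0 < ct r)
    (hM : ∀ x, Ct *ᵥ x ≤ ct → Ct *ᵥ (M *ᵥ x) ≤ ct) {x : Fin n → ℝ}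
    (hx : ∀ r, (Ct *ᵥ x) r < ct r) (r : Fin qT) : (Ct *ᵥ (M *ᵥ x)) r < ct r := by
  obtain ⟨t, ht0, -, ht⟩ := exists_pos_forall_mulVec_add_smul_lt Ct ct x x hx
  have h := hM _ (fun r => (ht r).le) r
  simp only [mulVec_add, mulVec_smul, Pi.add_apply, Pi.smul_apply, smul_eq_mul] at h
  by_contra! hle
  nlinarith [h0 r, mul_pos ht0 (h0 r), mul_le_mul_of_nonneg_left hle ht0.le]

/-- Shifting an optimal sequence with inactive terminal constraints by one step, and appending
a feedback `K` that attains the minimum of the one-step problem with terminal cost `P`, is again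
optimal for the successor state. -/
theorem IsOptimal.shift {K : Matrix (Fin m) (Fin n) ℝ} (hQ : Q.PosSemidef) (hR : R.PosDef)
    (hP : P.PosSemidef)
    (hle : ∀ (x : Fin n → ℝ) (w : Fin m → ℝ), x ⬝ᵥ (P *ᵥ x) ≤
      (A *ᵥ x + B *ᵥ w) ⬝ᵥ (P *ᵥ (A *ᵥ x + B *ᵥ w)) + x ⬝ᵥ (Q *ᵥ x) + w ⬝ᵥ (R *ᵥ w))
    (heq : ∀ x : Fin n → ℝ, (A *ᵥ x + B *ᵥ (K *ᵥ x)) ⬝ᵥ (P *ᵥ (A *ᵥ x + B *ᵥ (K *ᵥ x))) +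
      x ⬝ᵥ (Q *ᵥ x) + (K *ᵥ x) ⬝ᵥ (R *ᵥ (K *ᵥ x)) = x ⬝ᵥ (P *ᵥ x))
    (hTX : ∀ x, Ct *ᵥ x ≤ ct → Cx *ᵥ x ≤ cx) (hTU : ∀ x, Ct *ᵥ x ≤ ct → Cu *ᵥ (K *ᵥ x) ≤ cu)
    (hTT : ∀ x, Ct *ᵥ x ≤ ct → Ct *ᵥ (A *ᵥ x + B *ᵥ (K *ᵥ x)) ≤ ct)
    (hu : IsOptimal A B Q R P Cx cx Cu cu Ct ct N x0 u)
    (hT : ∀ r, (Ct *ᵥ traj A B x0 u N) r < ct r) (huN : u N = K *ᵥ traj A B x0 u N) :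
    IsOptimal A B Q R P Cx cx Cu cu Ct ct N (A *ᵥ x0 + B *ᵥ u 0) (fun i => u (i + 1)) := by
  refine ⟨⟨fun k hk => ?_, ?_⟩, fun v hv => ?_⟩
  · rw [← traj_succ']
    rcases (show k + 1 < N ∨ k + 1 = N by omega) with h | h
    · exact hu.1.1 _ h
    · simp only [h, huN]
      exact ⟨hTX _ hu.1.2, hTU _ hu.1.2⟩
  · rw [← traj_succ']
    simp only [traj, huN]
    exact hTT _ hu.1.2
  · let c : ℕ → Fin m → ℝ := fun k => Nat.casesOn k (u 0) v
    have hc : ∀ k < N, Cx *ᵥ traj A B x0 c k ≤ cx ∧ Cu *ᵥ c k ≤ cu := by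
      rintro (_ | k) hk
      · exact hu.1.1 0 hk
      · rw [traj_succ']
        exact hv.1 k (by omega)
    have h1 := hu.cost_le_of_terminal_inactive hQ hR hP hT hc
    have h2 := cost_succ A B (Q := Q) (R := R) (P := P) N x0 c
    have h3 := cost_succ' A B (Q := Q) (R := R) (P := P) N x0 c
    have h4 := cost_succ A B (Q := Q) (R := R) (P := P) N x0 u
    have h5 := cost_succ' A B (Q := Q) (R := R) (P := P) N x0 u
    have h6 := hle (traj A B x0 c N) (c N)
    have h7 := heq (traj A B x0 u N)
    rw [huN] at h4
    change _ = _ + cost A B Q R P N (A *ᵥ x0 + B *ᵥ u 0) v at h3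
    change _ = (1 / 2) * (_ + u 0 ⬝ᵥ (R *ᵥ u 0)) + _ at h3
    linarith

end Optimality

/-- `ℙ_N` is positive invariant under the open-loop optimally controlled system:
the extended optimal trajectory of any `x0 ∈ ℙ_N` stays in `ℙ_N`. -/
theorem stmt6
    {n m qX qU qT : ℕ}
    (A : Matrix (Fin n) (Fin n) ℝ) (B : Matrix (Fin n) (Fin m) ℝ)
    (Q : Matrix (Fin n) (Fin n) ℝ) (R : Matrix (Fin m) (Fin m) ℝ)
    (P : Matrix (Fin n) (Fin n) ℝ)
    (Cx : Matrix (Fin qX) (Fin n) ℝ) (cx : Fin qX → ℝ)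
    (Cu : Matrix (Fin qU) (Fin m) ℝ) (cu : Fin qU → ℝ)
    (Ct : Matrix (Fin qT) (Fin n) ℝ) (ct : Fin qT → ℝ)
    (hQ : Q.PosSemidef) (hR : R.PosDef) (hP : P.PosSemidef)
    (Kinf : Matrix (Fin m) (Fin n) ℝ)
    (hdet : IsUnit (R + Bᵀ * P * B).det)
    (hRic : P = Aᵀ * (P - P * B * (R + Bᵀ * P * B)⁻¹ * (Bᵀ * P)) * A + Q)
    (hK : Kinf = -((Bᵀ * P * B + R)⁻¹ * (Bᵀ * P * A)))
    (Xs : Set (Fin n → ℝ)) (hXs : Xs = {x | Cx *ᵥ x ≤ cx})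
    (Us : Set (Fin m → ℝ)) (hUs : Us = {v | Cu *ᵥ v ≤ cu})
    (Ts : Set (Fin n → ℝ)) (hTs : Ts = {x | Ct *ᵥ x ≤ ct})
    (XU : Set (Fin n → ℝ)) (hXU : XU = {x ∈ Xs | Kinf *ᵥ x ∈ Us})
    (hTchar : Ts = {x ∈ Xs | ∀ k : ℕ, ((A + B * Kinf) ^ k) *ᵥ x ∈ XU})
    (hXc : IsCompact Xs) (hUc : IsCompact Us) (hTc : IsCompact Ts)
    (hX0 : (0 : Fin n → ℝ) ∈ interior Xs)
    (hU0 : (0 : Fin m → ℝ) ∈ interior Us)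
    (hT0 : (0 : Fin n → ℝ) ∈ interior Ts)
    (hXint : interior Xs = {x | ∀ i, (Cx *ᵥ x) i < cx i})
    (hUint : interior Us = {v | ∀ j, (Cu *ᵥ v) j < cu j})
    (hTint : interior Ts = {x | ∀ r, (Ct *ᵥ x) r < ct r})
    (N : ℕ) (hN : 1 ≤ N)
    (PN : Set (Fin n → ℝ))
    (hPN : PN = {x | ∃ w, IsOptimal A B Q R P Cx cx Cu cu Ct ct N x w ∧ ∀ r, (Ct *ᵥ traj A B x w N) r < ct r})
    (x0 : Fin n → ℝ) (hx0 : x0 ∈ PN)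
    (u : ℕ → Fin m → ℝ) (hu : IsOptimal A B Q R P Cx cx Cu cu Ct ct N x0 u)
    (uext : ℕ → Fin m → ℝ)
    (huext : uext = fun k => if k < N then u k
      else Kinf *ᵥ (((A + B * Kinf) ^ (k - N)) *ᵥ traj A B x0 u N)) :
    ∀ k : ℕ, traj A B x0 uext k ∈ PN := by
  have hsq := riccati_completion_of_squares A B hP.isHermitian hR.isHermitian hdet hRic hK
  have hS : (R + Bᵀ * P * B).PosSemidef := by
    refine hR.posSemidef.add ?_
    simpa [conjTranspose_eq_transpose_of_trivial] using hP.conjTranspose_mul_mul_same B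
  have hT_iff (x : Fin n → ℝ) : Ct *ᵥ x ≤ ct ↔
      Cx *ᵥ x ≤ cx ∧ ∀ k : ℕ, Cx *ᵥ (((A + B * Kinf) ^ k) *ᵥ x) ≤ cx ∧
        Cu *ᵥ (Kinf *ᵥ (((A + B * Kinf) ^ k) *ᵥ x)) ≤ cu := by
    have h : x ∈ Ts ↔ x ∈ Xs ∧ ∀ k : ℕ, ((A + B * Kinf) ^ k) *ᵥ x ∈ XU := by
      conv_lhs => rw [hTchar]
      rfl
    rw [hXU] at h
    rw [hTs, hXs, hUs] at h
    exact h
  have hAK (x : Fin n → ℝ) : A *ᵥ x + B *ᵥ (Kinf *ᵥ x) = (A + B * Kinf) *ᵥ x := by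
    rw [add_mulVec, mulVec_mulVec]
  have hTT (x : Fin n → ℝ) (hx : Ct *ᵥ x ≤ ct) : Ct *ᵥ ((A + B * Kinf) *ᵥ x) ≤ ct := by
    rw [hT_iff] at hx ⊢
    refine ⟨by simpa using (hx.2 1).1, fun k => ?_⟩
    simpa only [mulVec_mulVec, ← pow_succ] using hx.2 (k + 1)
  have hct (r : Fin qT) : 0 < ct r := by
    rw [hTint] at hT0
    simpa using hT0 r
  have huu (k : ℕ) (hk : k < N) : u k = uext k := by simp [huext, hk]
  have huextN (k : ℕ) : traj A B x0 uext (k + N) = ((A + B * Kinf) ^ k) *ᵥ traj A B x0 u N ∧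
      uext (k + N) = Kinf *ᵥ traj A B x0 uext (k + N) := by
    have hval (k : ℕ) :
        uext (k + N) = Kinf *ᵥ (((A + B * Kinf) ^ k) *ᵥ traj A B x0 u N) := by
      simp [huext]
    induction k with
    | zero =>
      have h : traj A B x0 uext (0 + N) = ((A + B * Kinf) ^ 0) *ᵥ traj A B x0 u N := by
        rw [Nat.zero_add, pow_zero, one_mulVec, traj_congr A B x0 huu]
      exact ⟨h, by rw [h, hval]⟩
    | succ k ih =>
      have h : traj A B x0 uext (k + 1 + N) =
          ((A + B * Kinf) ^ (k + 1)) *ᵥ traj A B x0 u N := by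
        rw [Nat.add_right_comm]
        simp only [traj]
        rw [ih.2, ih.1, hAK, mulVec_mulVec, ← pow_succ']
      exact ⟨h, by rw [h, hval]⟩
  have hstep (y : Fin n → ℝ) (w : ℕ → Fin m → ℝ)
      (hw : IsOptimal A B Q R P Cx cx Cu cu Ct ct N y w)
      (hwT : ∀ r, (Ct *ᵥ traj A B y w N) r < ct r) (hwN : w N = Kinf *ᵥ traj A B y w N) :
      IsOptimal A B Q R P Cx cx Cu cu Ct ct N (A *ᵥ y + B *ᵥ w 0) (fun i => w (i + 1)) := by
    refine hw.shift hQ hR hP (fun x v => ?_) (fun x => ?_) (fun x hx => ((hT_iff x).1 hx).1)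
      (fun x hx => ?_) (fun x hx => ?_) hwT hwN
    · rw [hsq]
      linarith [hS.dotProduct_mulVec_self_nonneg (v - Kinf *ᵥ x)]
    · rw [hsq]
      simp
    · simpa using (((hT_iff x).1 hx).2 0).2
    · rw [hAK]
      exact hTT x hx
  have key (k : ℕ) : IsOptimal A B Q R P Cx cx Cu cu Ct ct N (traj A B x0 uext k)
        (fun i => uext (k + i)) ∧
      ∀ r, (Ct *ᵥ traj A B (traj A B x0 uext k) (fun i => uext (k + i)) N) r < ct r := by
    induction k with
    | zero =>
      rw [hPN] at hx0
      obtain ⟨w, hw, hwT⟩ := hx0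
      have hwu (k : ℕ) (hk : k < N) : w k = uext (0 + k) := by
        rw [hu.eq_of_lt hQ hR hP hw hk, huu k hk, Nat.zero_add]
      refine ⟨hw.congr hwu, ?_⟩
      change ∀ r, (Ct *ᵥ traj A B x0 (fun i => uext (0 + i)) N) r < ct r
      rwa [← traj_congr A B x0 hwu]
    | succ k ih =>
      have hlast : uext (k + N) =
          Kinf *ᵥ traj A B (traj A B x0 uext k) (fun i => uext (k + i)) N := by
        rw [traj_add]
        exact (huextN k).2
      have hshift : (fun i => uext (k + 1 + i)) = fun i => uext (k + (i + 1)) := by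
        funext i
        rw [Nat.add_right_comm, Nat.add_assoc]
      rw [hshift]
      have hopt := hstep (traj A B x0 uext k) (fun i => uext (k + i)) ih.1 ih.2 hlast
      refine ⟨hopt, ?_⟩
      intro r
      have h := mulVec_lt_of_invariant (A + B * Kinf) hct hTT ih.2 r
      rw [← hAK, ← hlast] at h
      rw [← hshift, traj_add, Nat.add_right_comm]
      rwa [traj_add] at h
  intro k
  rw [hPN]
  exact ⟨_, key k⟩
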